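/- arXiv:2304.02548 — 3 statements merged into one kernel-verified Lean document; each statement's English description precedes it below -/
import Mathlib

section
/- Fix α ≠ 0 and let F be a positive, α-homogeneous functional on convex bodies of ℝⁿ satisfying property (C), with associated measures σ_K. Then for every convex body K with 0 in its interior, F has the representation F(K) = (1/|α|) ∫_{S^{n−1}} h_K(u) dσ_K(u). -/
open MeasureTheory Filter Topology
open scoped InnerProductSpace ENNReal Pointwise

noncomputable section

/-- The unit sphere `S^{n-1}` of `ℝⁿ`. -/
def unitSphere (n : ℕ) : Set (EuclideanSpace ℝ (Fin n)) := Metric.sphere 0 1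

/-- A convex body: compact, convex, with nonempty interior. -/
def IsConvexBody {n : ℕ} (K : Set (EuclideanSpace ℝ (Fin n))) : Prop :=
  IsCompact K ∧ Convex ℝ K ∧ (interior K).Nonempty

/-- The support function `h_K(u) = sup_{y ∈ K} ⟨y, u⟩`. -/
def suppFn {n : ℕ} (K : Set (EuclideanSpace ℝ (Fin n))) (u : EuclideanSpace ℝ (Fin n)) : ℝ :=
  sSup ((fun y => ⟪y, u⟫_ℝ) '' K)

/-- The Wulff shape of a function `f` on the sphere. -/
def wulff {n : ℕ} (f : EuclideanSpace ℝ (Fin n) → ℝ) : Set (EuclideanSpace ℝ (Fin n)) :=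
  {x | ∀ u ∈ unitSphere n, ⟪x, u⟫_ℝ ≤ f u}

/-- A compact convex set is the Wulff shape of its support function. -/
theorem wulff_suppFn {n : ℕ} {K : Set (EuclideanSpace ℝ (Fin n))} (hK : IsCompact K)
    (hconv : Convex ℝ K) (hne : K.Nonempty) : wulff (suppFn K) = K := by
  ext x
  refine ⟨fun hx => ?_, fun hx u _ => ?_⟩
  · by_contra hxK
    obtain ⟨f, a, hfa, hax⟩ := geometric_hahn_banach_closed_point hconv hK.isClosed hxK
    set v := (InnerProductSpace.toDual ℝ (EuclideanSpace ℝ (Fin n))).symm f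
    have hv : ∀ y, f y = ⟪y, v⟫_ℝ := fun y => by
      rw [real_inner_comm, InnerProductSpace.toDual_symm_apply]
    have hv0 : v ≠ 0 := fun h => by
      obtain ⟨y, hy⟩ := hne
      have hlt := (hfa y hy).trans hax
      simp [hv, h] at hlt
    have hpos : 0 < ‖v‖ := norm_pos_iff.2 hv0
    have hle : ⟪x, ‖v‖⁻¹ • v⟫_ℝ ≤ suppFn K (‖v‖⁻¹ • v) :=
      hx _ (by simp [unitSphere, norm_smul, hpos.ne'])
    have hsup : suppFn K (‖v‖⁻¹ • v) ≤ ‖v‖⁻¹ * a := by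
      refine csSup_le (hne.image _) ?_
      rintro _ ⟨y, hy, rfl⟩
      simp only [real_inner_smul_right, ← hv]
      exact mul_le_mul_of_nonneg_left (hfa y hy).le (inv_nonneg.2 hpos.le)
    have hlt : ‖v‖⁻¹ * a < ‖v‖⁻¹ * f x := mul_lt_mul_of_pos_left hax (inv_pos.2 hpos)
    rw [real_inner_smul_right, ← hv] at hle
    linarith
  · exact le_csSup (hK.image (by fun_prop)).bddAbove ⟨x, hx, rfl⟩

/-- Scaling a function by a positive constant scales its Wulff shape. -/
theorem wulff_mul_const {n : ℕ} (f : EuclideanSpace ℝ (Fin n) → ℝ) {c : ℝ} (hc : 0 < c) :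
    wulff (fun u => f u * c) = c • wulff f := by
  ext x
  rw [Set.mem_smul_set_iff_inv_smul_mem₀ hc.ne']
  refine forall₂_congr fun u _ => ?_
  rw [real_inner_smul_left, inv_mul_le_iff₀ hc, mul_comm]

/-- an `α`-homogeneous functional with Hadamard derivative (property (C))
has the integral representation `F(K) = (1/|α|) ∫ h_K dσ_K`. -/
theorem homogeneous_hadamard_representation (n : ℕ)
    (α : ℝ) (hα : α ≠ 0)
    (F : Set (EuclideanSpace ℝ (Fin n)) → ℝ)
    (hFpos : ∀ K, IsConvexBody K → 0 < F K)
    (hFhom : ∀ K, IsConvexBody K → ∀ t : ℝ, 0 < t → F (t • K) = t ^ α * F K)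
    -- property (C): Hadamard derivative, with associated measures `σ K`
    (σ : Set (EuclideanSpace ℝ (Fin n)) → Measure (EuclideanSpace ℝ (Fin n)))
    (hσfin : ∀ K, IsFiniteMeasure (σ K))
    (hσsupp : ∀ K, (σ K) (unitSphere n)ᶜ = 0)
    (hC : ∀ K, IsConvexBody K → 0 ∈ interior K →
      ∀ f : EuclideanSpace ℝ (Fin n) → ℝ, Continuous f →
      Tendsto (fun t : ℝ =>
          (F (wulff (fun u => suppFn K u * Real.exp (t * f u))) - F K) / t)
        (𝓝[≠] (0 : ℝ))
        (𝓝 (Real.sign α * ∫ u, suppFn K u * f u ∂(σ K)))) :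
    ∀ K, IsConvexBody K → 0 ∈ interior K →
      F K = (1 / |α|) * ∫ u, suppFn K u ∂(σ K) := by
  intro K hK h0
  have hlim := hC K hK h0 (fun _ => 1) continuous_const
  have hF : ∀ t : ℝ, F (wulff (fun u => suppFn K u * Real.exp t)) =
      Real.exp (t * α) * F K := fun t => by
    rw [wulff_mul_const _ (Real.exp_pos t),
      wulff_suppFn hK.1 hK.2.1 ⟨0, interior_subset h0⟩, hFhom K hK _ (Real.exp_pos t),
      ← Real.exp_mul]
  simp only [mul_one, hF] at hlim
  have hderiv : HasDerivAt (fun t : ℝ => Real.exp (t * α) * F K) (α * F K) 0 := by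
    simpa using (((hasDerivAt_id (0 : ℝ)).mul_const α).exp.mul_const (F K))
  rw [hasDerivAt_iff_tendsto_slope_zero] at hderiv
  have hderiv' : Tendsto (fun t : ℝ => (Real.exp (t * α) * F K - F K) / t)
      (𝓝[≠] (0 : ℝ)) (𝓝 (α * F K)) := by
    simpa [div_eq_inv_mul] using hderiv
  have heq := tendsto_nhds_unique hderiv' hlim
  rcases hα.lt_or_gt with h | h
  · rw [Real.sign_of_neg h] at heq
    rw [abs_of_neg h]
    field_simp
    linarith
  · rw [Real.sign_of_pos h] at heq
    rw [abs_of_pos h]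
    field_simp
    linarith
end
end

section
/- Let n ≥ 1, let (K_i) be a sequence of convex bodies in ℝⁿ converging to a convex body K in the Hausdorff metric, and let φ_i, φ : ℝⁿ → [0,∞) be locally integrable functions such that φ_i → φ in L¹_loc, i.e. ∫_A |φ_i(x) − φ(x)| dx → 0 for every compact set A ⊆ ℝⁿ. Then ∫_{K_i} φ_i(x) dx → ∫_K φ(x) dx. -/
open MeasureTheory Filter Topology

/-- If every point of a closed ball of radius `s` is within distance less than `s` of a complete
convex set, then the centre of the ball belongs to the set. -/
theorem Convex.mem_of_closedBall_subset_thickening {E : Type*} [NormedAddCommGroup E]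
    [InnerProductSpace ℝ E] {C : Set E} (hc : Convex ℝ C) (hC : IsComplete C)
    (hne : C.Nonempty) {x : E} {s : ℝ} (hs : 0 ≤ s)
    (h : Metric.closedBall x s ⊆ Metric.thickening s C) : x ∈ C := by
  obtain ⟨w, hw, hmin⟩ := exists_norm_eq_iInf_of_complete_convex hne hC hc x
  rw [norm_eq_iInf_iff_real_inner_le_zero hc hw] at hmin
  by_contra hx
  have hv : 0 < ‖x - w‖ := norm_pos_iff.2 (sub_ne_zero.2 fun e => hx (e ▸ hw))
  obtain ⟨y, hy, hpy⟩ := Metric.mem_thickening_iff.1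
    (@h (x + (s / ‖x - w‖) • (x - w)) (by
      rw [Metric.mem_closedBall, dist_eq_norm, add_sub_cancel_left, norm_smul, Real.norm_eq_abs,
        abs_of_nonneg (by positivity), div_mul_cancel₀ _ hv.ne']))
  rw [dist_eq_norm] at hpy
  have hsum : x + (s / ‖x - w‖) • (x - w) - y
      = (s / ‖x - w‖) • (x - w) + (x - w) - (y - w) := by abel
  have hinner : inner ℝ (x - w) (x + (s / ‖x - w‖) • (x - w) - y)
      = s * ‖x - w‖ + ‖x - w‖ ^ 2 - inner ℝ (x - w) (y - w) := by
    rw [hsum, inner_sub_right, inner_add_right, real_inner_smul_right,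
      real_inner_self_eq_norm_sq]
    field_simp
  have hcs := real_inner_le_norm (x - w) (x + (s / ‖x - w‖) • (x - w) - y)
  have := hmin y hy
  nlinarith [mul_lt_mul_of_pos_left hpy hv]

section HausdorffConvergence

variable {ι E : Type*} {l : Filter ι} {K : ι → Set E} {L : Set E}

/-- A family of nonempty bounded sets converging to `L` in the Hausdorff distance is eventually
contained in every thickening of `L`. -/
theorem eventually_subset_thickening_of_tendsto_hausdorffDist [PseudoMetricSpace E]
    (hK : ∀ i, Bornology.IsBounded (K i)) (hKne : ∀ i, (K i).Nonempty)
    (hL : Bornology.IsBounded L) (hLne : L.Nonempty)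
    (h : Tendsto (fun i => Metric.hausdorffDist (K i) L) l (𝓝 0)) {r : ℝ} (hr : 0 < r) :
    ∀ᶠ i in l, K i ⊆ Metric.thickening r L := by
  filter_upwards [h.eventually_lt_const hr] with i hi x hx
  exact Metric.mem_thickening_iff.2 (Metric.exists_dist_lt_of_hausdorffDist_lt hx hi
    (Metric.hausdorffEDist_ne_top_of_nonempty_of_bounded (hKne i) hLne (hK i) hL))

/-- An interior point of the Hausdorff limit of compact convex sets eventually belongs to
these sets. -/
theorem eventually_mem_of_tendsto_hausdorffDist [NormedAddCommGroup E] [InnerProductSpace ℝ E]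
    (hK : ∀ i, IsCompact (K i)) (hKc : ∀ i, Convex ℝ (K i)) (hKne : ∀ i, (K i).Nonempty)
    (hL : Bornology.IsBounded L)
    (h : Tendsto (fun i => Metric.hausdorffDist (K i) L) l (𝓝 0)) {x : E}
    (hx : x ∈ interior L) : ∀ᶠ i in l, x ∈ K i := by
  obtain ⟨s, hs, hsL⟩ := Metric.nhds_basis_closedBall.mem_iff.1 (mem_interior_iff_mem_nhds.1 hx)
  filter_upwards [h.eventually_lt_const hs] with i hi
  refine (hKc i).mem_of_closedBall_subset_thickening (hK i).isComplete (hKne i) hs.le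
    fun y hy => ?_
  obtain ⟨z, hz, hzy⟩ := Metric.exists_dist_lt_of_hausdorffDist_lt' (hsL hy) hi
    (Metric.hausdorffEDist_ne_top_of_nonempty_of_bounded (hKne i) ⟨x, interior_subset hx⟩
      (hK i).isBounded hL)
  exact Metric.mem_thickening_iff.2 ⟨z, hz, by rwa [dist_comm]⟩

/-- A point outside the closed Hausdorff limit of nonempty bounded sets eventually lies outside
these sets. -/
theorem eventually_notMem_of_tendsto_hausdorffDist [PseudoMetricSpace E]
    (hK : ∀ i, Bornology.IsBounded (K i)) (hKne : ∀ i, (K i).Nonempty)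
    (hL : Bornology.IsBounded L) (hLne : L.Nonempty) (hLc : IsClosed L)
    (h : Tendsto (fun i => Metric.hausdorffDist (K i) L) l (𝓝 0)) {x : E} (hx : x ∉ L) :
    ∀ᶠ i in l, x ∉ K i := by
  have hpos : 0 < Metric.infDist x L := (hLc.notMem_iff_infDist_pos hLne).1 hx
  filter_upwards [eventually_subset_thickening_of_tendsto_hausdorffDist hK hKne hL hLne h hpos]
    with i hi hxi
  obtain ⟨z, hz, hzx⟩ := Metric.mem_thickening_iff.1 (hi hxi)
  exact (Metric.infDist_le_dist_of_mem hz).not_gt hzx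

/-- The integral of a fixed locally integrable function over a compact convex set is continuous
with respect to Hausdorff convergence. -/
theorem tendsto_setIntegral_of_tendsto_hausdorffDist [l.IsCountablyGenerated]
    [NormedAddCommGroup E] [InnerProductSpace ℝ E] [FiniteDimensional ℝ E] [MeasurableSpace E]
    [BorelSpace E] {μ : Measure E} [μ.IsAddHaarMeasure]
    (hK : ∀ i, IsCompact (K i)) (hKc : ∀ i, Convex ℝ (K i)) (hKne : ∀ i, (K i).Nonempty)
    (hL : IsCompact L) (hLc : Convex ℝ L) (hLne : L.Nonempty)
    (h : Tendsto (fun i => Metric.hausdorffDist (K i) L) l (𝓝 0)) {f : E → ℝ}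
    (hf : LocallyIntegrable f μ) :
    Tendsto (fun i => ∫ x in K i, f x ∂μ) l (𝓝 (∫ x in L, f x ∂μ)) := by
  simp_rw [← integral_indicator (hK _).measurableSet, ← integral_indicator hL.measurableSet]
  have hA : IsCompact (Metric.cthickening 1 L) := hL.cthickening
  refine tendsto_integral_filter_of_dominated_convergence
    ((Metric.cthickening 1 L).indicator fun x => ‖f x‖) ?_ ?_ ?_ ?_
  · exact Eventually.of_forall fun i =>
      hf.aestronglyMeasurable.indicator (hK i).measurableSet
  · filter_upwards [eventually_subset_thickening_of_tendsto_hausdorffDist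
      (fun i => (hK i).isBounded) hKne hL.isBounded hLne h one_pos] with i hi
    refine Eventually.of_forall fun x => ?_
    rw [norm_indicator_eq_indicator_norm]
    exact Set.indicator_le_indicator_of_subset
      (hi.trans (Metric.thickening_subset_cthickening 1 L)) (fun _ => norm_nonneg _) x
  · exact (integrable_indicator_iff hA.measurableSet).2 (hf.integrableOn_isCompact hA).norm
  · filter_upwards [measure_eq_zero_iff_ae_notMem.1 (hLc.addHaar_frontier μ)] with x hx
    refine tendsto_nhds_of_eventually_eq ?_
    by_cases hxL : x ∈ L
    · have hxint : x ∈ interior L := by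
        by_contra hxi
        exact hx ⟨subset_closure hxL, hxi⟩
      filter_upwards [eventually_mem_of_tendsto_hausdorffDist hK hKc hKne hL.isBounded h hxint]
        with i hi
      rw [Set.indicator_of_mem hi, Set.indicator_of_mem hxL]
    · filter_upwards [eventually_notMem_of_tendsto_hausdorffDist (fun i => (hK i).isBounded) hKne
        hL.isBounded hLne hL.isClosed h hxL] with i hi
      rw [Set.indicator_of_notMem hi, Set.indicator_of_notMem hxL]

end HausdorffConvergence

/-- If convex bodies `K i` converge to a convex body `L` in the Hausdorff
metric and nonnegative locally integrable densities `φ i` converge to `φ₀` in `L¹_loc`,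
then `∫_{K i} φ i → ∫_L φ₀`. -/
theorem diagonal_set_valued_measure_continuous (n : ℕ) (hn : 1 ≤ n)
    (K : ℕ → Set (EuclideanSpace ℝ (Fin n))) (L : Set (EuclideanSpace ℝ (Fin n)))
    (hK : ∀ i, IsCompact (K i) ∧ Convex ℝ (K i) ∧ (interior (K i)).Nonempty)
    (hL : IsCompact L ∧ Convex ℝ L ∧ (interior L).Nonempty)
    (hconv : Tendsto (fun i => Metric.hausdorffDist (K i) L) atTop (𝓝 0))
    (φ : ℕ → EuclideanSpace ℝ (Fin n) → ℝ) (φ₀ : EuclideanSpace ℝ (Fin n) → ℝ)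
    (hφnn : ∀ i x, 0 ≤ φ i x) (hφ₀nn : ∀ x, 0 ≤ φ₀ x)
    (hφloc : ∀ i, LocallyIntegrable (φ i) volume) (hφ₀loc : LocallyIntegrable φ₀ volume)
    (hL1 : ∀ A : Set (EuclideanSpace ℝ (Fin n)), IsCompact A →
      Tendsto (fun i => ∫ x in A, |φ i x - φ₀ x|) atTop (𝓝 0)) :
    Tendsto (fun i => ∫ x in K i, φ i x) atTop (𝓝 (∫ x in L, φ₀ x)) := by
  have hKne : ∀ i, (K i).Nonempty := fun i => (hK i).2.2.mono interior_subset
  have hLne : L.Nonempty := hL.2.2.mono interior_subset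
  have hfix := tendsto_setIntegral_of_tendsto_hausdorffDist (fun i => (hK i).1)
    (fun i => (hK i).2.1) hKne hL.1 hL.2.1 hLne hconv hφ₀loc
  have hA : IsCompact (Metric.cthickening 1 L) := hL.1.cthickening
  have hdiff : Tendsto (fun i => (∫ x in K i, φ i x) - ∫ x in K i, φ₀ x) atTop (𝓝 0) := by
    refine squeeze_zero_norm' ?_ (hL1 _ hA)
    filter_upwards [eventually_subset_thickening_of_tendsto_hausdorffDist
      (fun i => (hK i).1.isBounded) hKne hL.1.isBounded hLne hconv one_pos] with i hi
    rw [← integral_sub ((hφloc i).integrableOn_isCompact (hK i).1)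
      (hφ₀loc.integrableOn_isCompact (hK i).1)]
    refine (norm_integral_le_integral_norm _).trans (setIntegral_mono_set ?_ ?_ ?_)
    · exact (((hφloc i).sub hφ₀loc).integrableOn_isCompact hA).norm
    · exact Eventually.of_forall fun x => norm_nonneg _
    · exact (hi.trans (Metric.thickening_subset_cthickening 1 L)).eventuallyLE
  simpa using hdiff.add hfix
end

section
/- Let n ≥ 1, let ν be an even Borel probability measure on S^{n−1}, fix α ≠ 0, and let F be a positive, α-homogeneous functional on convex bodies of ℝⁿ satisfying property (C), with associated measures σ_K. Let K₀ be a convex body with 0 in its interior and F(K₀) = 1, let g be a continuous function on S^{n−1}, and set h_t = h_{K₀} e^{tg} and Γ(q) = F([q])^{−1/α} · exp(∫_{S^{n−1}} log q dν) for positive continuous q on S^{n−1}. Then the function t ↦ Γ(h_t) is differentiable at t = 0, with derivative d/dt Γ(h_t)|_{t=0} = exp(∫_{S^{n−1}} log h_{K₀} dν) · [ ∫_{S^{n−1}} g dν − (1/|α|) ∫_{S^{n−1}} g(u) h_{K₀}(u) dσ_{K₀}(u) ]. -/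
open MeasureTheory Filter Topology
open scoped InnerProductSpace ENNReal Pointwise

noncomputable section

/-- The linear functionals in the direction `u` are bounded above on a compact set. -/
theorem IsCompact.bddAbove_inner_image {n : ℕ} {K : Set (EuclideanSpace ℝ (Fin n))}
    (hK : IsCompact K) (u : EuclideanSpace ℝ (Fin n)) :
    BddAbove ((fun y => ⟪y, u⟫_ℝ) '' K) :=
  (hK.image (by fun_prop)).bddAbove

theorem continuous_suppFn {n : ℕ} {K : Set (EuclideanSpace ℝ (Fin n))} (hK : IsCompact K) :
    Continuous (suppFn K) := by
  refine hK.continuous_sSup (f := fun u y : EuclideanSpace ℝ (Fin n) => ⟪y, u⟫_ℝ) ?_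
  fun_prop

/-- The support function is positive away from the origin when `0` is an interior point. -/
theorem suppFn_pos {n : ℕ} {K : Set (EuclideanSpace ℝ (Fin n))} (hK : IsCompact K)
    (h0 : 0 ∈ interior K) {u : EuclideanSpace ℝ (Fin n)} (hu : u ≠ 0) : 0 < suppFn K u := by
  have hlim : Tendsto (fun r : ℝ => r • u) (𝓝[>] 0) (𝓝 0) := by
    have : Continuous fun r : ℝ => r • u := by fun_prop
    simpa using (this.tendsto 0).mono_left nhdsWithin_le_nhds
  obtain ⟨r, hrK, hr⟩ :=
    ((hlim.eventually (mem_interior_iff_mem_nhds.mp h0)).and self_mem_nhdsWithin).exists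
  have hr : 0 < r := hr
  have hle : ⟪r • u, u⟫_ℝ ≤ suppFn K u :=
    le_csSup (hK.bddAbove_inner_image u) ⟨r • u, hrK, rfl⟩
  refine lt_of_lt_of_le ?_ hle
  rw [real_inner_smul_left]
  exact mul_pos hr (real_inner_self_pos.mpr hu)

/-- A function continuous on the sphere is integrable for a finite measure carried by the sphere. -/
theorem ContinuousOn.integrable_of_unitSphere {n : ℕ}
    {ν : Measure (EuclideanSpace ℝ (Fin n))} [IsFiniteMeasure ν]
    (hν : ν (unitSphere n)ᶜ = 0) {f : EuclideanSpace ℝ (Fin n) → ℝ}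
    (hf : ContinuousOn f (unitSphere n)) : Integrable f ν := by
  have hae : ∀ᵐ u ∂ν, u ∈ unitSphere n := mem_ae_iff.mpr hν
  have h : IntegrableOn f (unitSphere n) ν := hf.integrableOn_compact (isCompact_sphere 0 1)
  rwa [IntegrableOn, Measure.restrict_eq_self_of_ae_mem hae] at h

/-- along a logarithmic perturbation `h_t = h_{K₀} e^{t g}`, the functional
`Γ(q) = F([q])^{-1/α} exp(∫ log q dν)` is differentiable at `t = 0`, with derivative
`exp(∫ log h_{K₀} dν) · (∫ g dν − (1/|α|) ∫ g h_{K₀} dσ_{K₀})`. -/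
theorem gamma_hasDerivAt_zero (n : ℕ) (hn : 1 ≤ n)
    (ν : Measure (EuclideanSpace ℝ (Fin n))) [IsProbabilityMeasure ν]
    (hνsupp : ν (unitSphere n)ᶜ = 0)
    (hνeven : ν.map (fun x => -x) = ν)
    (α : ℝ) (hα : α ≠ 0)
    (F : Set (EuclideanSpace ℝ (Fin n)) → ℝ)
    (hFpos : ∀ K, IsConvexBody K → 0 < F K)
    (hFhom : ∀ K, IsConvexBody K → ∀ t : ℝ, 0 < t → F (t • K) = t ^ α * F K)
    -- property (C): Hadamard derivative, with associated measures `σ K`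
    (σ : Set (EuclideanSpace ℝ (Fin n)) → Measure (EuclideanSpace ℝ (Fin n)))
    (hσfin : ∀ K, IsFiniteMeasure (σ K))
    (hσsupp : ∀ K, (σ K) (unitSphere n)ᶜ = 0)
    (hC : ∀ K, IsConvexBody K → 0 ∈ interior K →
      ∀ f : EuclideanSpace ℝ (Fin n) → ℝ, Continuous f →
      Tendsto (fun t : ℝ =>
          (F (wulff (fun u => suppFn K u * Real.exp (t * f u))) - F K) / t)
        (𝓝[≠] (0 : ℝ))
        (𝓝 (Real.sign α * ∫ u, suppFn K u * f u ∂(σ K))))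
    (K₀ : Set (EuclideanSpace ℝ (Fin n)))
    (hK₀ : IsConvexBody K₀) (hK₀int : 0 ∈ interior K₀) (hK₀F : F K₀ = 1)
    (g : EuclideanSpace ℝ (Fin n) → ℝ) (hg : Continuous g) :
    HasDerivAt
      (fun t : ℝ =>
        (F (wulff (fun u => suppFn K₀ u * Real.exp (t * g u)))) ^ (-(1 / α)) *
          Real.exp (∫ u, Real.log (suppFn K₀ u * Real.exp (t * g u)) ∂ν))
      (Real.exp (∫ u, Real.log (suppFn K₀ u) ∂ν) *
        ((∫ u, g u ∂ν) - (1 / |α|) * ∫ u, g u * suppFn K₀ u ∂(σ K₀)))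
      0 := by
  have hcompact := hK₀.1
  have hwulff : wulff (suppFn K₀) = K₀ :=
    wulff_suppFn hcompact hK₀.2.1 (hK₀.2.2.mono interior_subset)
  have hpos : ∀ u ∈ unitSphere n, 0 < suppFn K₀ u := fun u hu =>
    suppFn_pos hcompact hK₀int (ne_zero_of_mem_unit_sphere (⟨u, hu⟩ : Metric.sphere _ _))
  have hF : HasDerivAt (fun t : ℝ => F (wulff fun u => suppFn K₀ u * Real.exp (t * g u)))
      (Real.sign α * ∫ u, suppFn K₀ u * g u ∂(σ K₀)) 0 := by
    rw [hasDerivAt_iff_tendsto_slope]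
    refine (hC K₀ hK₀ hK₀int g hg).congr fun t => ?_
    simp [slope_def_field, hwulff]
  have hlogint : Integrable (fun u => Real.log (suppFn K₀ u)) ν :=
    ((continuous_suppFn hcompact).continuousOn.log
      fun u hu => (hpos u hu).ne').integrable_of_unitSphere hνsupp
  have hgint : Integrable g ν := hg.continuousOn.integrable_of_unitSphere hνsupp
  have hint : ∀ t : ℝ, ∫ u, Real.log (suppFn K₀ u * Real.exp (t * g u)) ∂ν
      = (∫ u, Real.log (suppFn K₀ u) ∂ν) + t * ∫ u, g u ∂ν := by
    intro t
    rw [← integral_const_mul, ← integral_add hlogint (hgint.const_mul t)]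
    refine integral_congr_ae ?_
    filter_upwards [mem_ae_iff.mpr hνsupp] with u hu
    rw [Real.log_mul (hpos u hu).ne' (Real.exp_ne_zero _), Real.log_exp]
  have hexp : HasDerivAt
      (fun t : ℝ => Real.exp ((∫ u, Real.log (suppFn K₀ u) ∂ν) + t * ∫ u, g u ∂ν))
      (Real.exp ((∫ u, Real.log (suppFn K₀ u) ∂ν) + 0 * ∫ u, g u ∂ν) * (1 * ∫ u, g u ∂ν)) 0 :=
    (((hasDerivAt_id (0 : ℝ)).mul_const _).const_add _).exp
  have hF0 : F (wulff fun u => suppFn K₀ u * Real.exp (0 * g u)) = 1 := by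
    simp [hwulff, hK₀F]
  have hprod := (hF.rpow_const (p := -(1 / α)) (Or.inl (by rw [hF0]; exact one_ne_zero))).mul hexp
  simp only [hint]
  refine hprod.congr_deriv ?_
  have hsign : Real.sign α * (1 / α) = 1 / |α| := by
    rcases hα.lt_or_gt with h | h
    · rw [Real.sign_of_neg h, abs_of_neg h]; field_simp
    · rw [Real.sign_of_pos h, abs_of_pos h]; field_simp
  rw [hF0]
  simp only [Real.one_rpow, zero_mul, add_zero, ← hsign, mul_comm (g _)]
  ring
end
end
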